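/- Let K be a quadratic separable field extension of F with Galois group {id, σ}. Then the set K₁₀,K := {X ∈ K₁₀ ⊗_F K : (τ⊗σ)(X) = X} is an F-subspace of K₁₀ ⊗_F K closed under multiplication and compatible with the ℤ/2-grading, of dimension 10 over F; moreover K₁₀,K ⊗_F K is isomorphic to K₁₀ ⊗_F K as K-superalgebras, and K₁₀,K is not isomorphic to K₁₀ as F-superalgebras. -/

import Mathlib

open scoped TensorProduct
noncomputable section
namespace Kac

/-! ### Superalgebra isomorphisms and automorphisms -/

@[ext]
structure SuperIso (S A B : Type) [CommRing S]
    [AddCommGroup A] [Module S A] [Mul A]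
    [AddCommGroup B] [Module S B] [Mul B]
    (evA odA : Submodule S A) (evB odB : Submodule S B) : Type where
  e : A ≃ₗ[S] B
  map_mul' : ∀ x y : A, e (x * y) = e x * e y
  map_even : evA.map e.toLinearMap = evB
  map_odd : odA.map e.toLinearMap = odB

abbrev SuperAut (S A : Type) [CommRing S] [AddCommGroup A] [Module S A] [Mul A]
    (ev od : Submodule S A) := SuperIso S A A ev od ev od

namespace SuperAut

variable {S A : Type} [CommRing S] [AddCommGroup A] [Module S A] [Mul A]
variable {ev od : Submodule S A}

private lemma map_symm {f : A ≃ₗ[S] A} {p : Submodule S A}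
    (h : p.map f.toLinearMap = p) : p.map f.symm.toLinearMap = p := by
  have h2 : f.symm.toLinearMap.comp f.toLinearMap = LinearMap.id := by
    ext x; simp
  calc p.map f.symm.toLinearMap
      = (p.map f.toLinearMap).map f.symm.toLinearMap := by rw [h]
    _ = p.map (f.symm.toLinearMap.comp f.toLinearMap) := by
        rw [Submodule.map_comp]
    _ = p := by rw [h2, Submodule.map_id]

instance : Group (SuperAut S A ev od) where
  one := ⟨LinearEquiv.refl S A, fun _ _ => rfl, Submodule.map_id _, Submodule.map_id _⟩
  mul f g := ⟨g.e.trans f.e,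
    fun x y => by simp [LinearEquiv.trans_apply, g.map_mul', f.map_mul'],
    by rw [LinearEquiv.coe_trans, Submodule.map_comp, g.map_even, f.map_even],
    by rw [LinearEquiv.coe_trans, Submodule.map_comp, g.map_odd, f.map_odd]⟩
  inv f := ⟨f.e.symm,
    fun x y => f.e.injective <| by simp [f.map_mul'],
    map_symm f.map_even, map_symm f.map_odd⟩
  mul_assoc f g h := by apply SuperIso.ext; apply LinearEquiv.ext; intro x; rfl
  one_mul f := by apply SuperIso.ext; apply LinearEquiv.ext; intro x; rfl
  mul_one f := by apply SuperIso.ext; apply LinearEquiv.ext; intro x; rfl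
  inv_mul_cancel f := by
    apply SuperIso.ext; apply LinearEquiv.ext; intro x
    exact f.e.symm_apply_apply x

end SuperAut

/-- The predicate that a pair of submodules `ev`, `od` makes a non-unital
(possibly non-associative) algebra `B` into a superalgebra. -/
def IsSuperalgebra (S B : Type) [CommRing S] [NonUnitalNonAssocRing B] [Module S B]
    (ev od : Submodule S B) : Prop :=
  ev ⊔ od = ⊤ ∧ ev ⊓ od = ⊥ ∧
  (∀ x ∈ ev, ∀ y ∈ ev, x * y ∈ ev) ∧ (∀ x ∈ ev, ∀ y ∈ od, x * y ∈ od) ∧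
  (∀ x ∈ od, ∀ y ∈ ev, x * y ∈ od) ∧ (∀ x ∈ od, ∀ y ∈ od, x * y ∈ ev)

/-! ### Submodules given by vanishing of coordinates -/

def stdSub (S R : Type) [Semiring S] [AddCommGroup R] [Module S R] (n : ℕ)
    (s : Set (Fin n)) : Submodule S (Fin n → R) where
  carrier := {x | ∀ i, i ∉ s → x i = 0}
  add_mem' := fun {a b} ha hb i hi => by
    simp [Pi.add_apply, ha i hi, hb i hi]
  zero_mem' := fun i _ => rfl
  smul_mem' := fun c x hx i hi => by
    simp [Pi.smul_apply, hx i hi]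

/-! ### Gradings by abelian groups -/

section Gradings

variable {G H S A : Type} [CommGroup G] [CommGroup H] [CommRing S]
  [AddCommGroup A] [Module S A] [Mul A]

/-- `comp` is a `G`-grading of the superalgebra `(A, ev, od)`. -/
def IsSuperGrading (ev od : Submodule S A) (comp : G → Submodule S A) : Prop :=
  (letI := Classical.decEq G; DirectSum.IsInternal comp) ∧
  (∀ (g h : G) (x y : A), x ∈ comp g → y ∈ comp h → x * y ∈ comp (g * h)) ∧
  (∀ g, comp g = (comp g ⊓ ev) ⊔ (comp g ⊓ od))

/-- The grading with homogeneous elements `w i` of degrees `d i`. -/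
def gradingOf (S : Type) {A G : Type} [CommRing S] [AddCommGroup A] [Module S A]
    [CommGroup G] {n : ℕ} (w : Fin n → A) (d : Fin n → G) : G → Submodule S A :=
  fun g => Submodule.span S (w '' {i | d i = g})

/-- Isomorphism of two `G`-gradings on a superalgebra. -/
def GradIso (ev od : Submodule S A) (comp comp' : G → Submodule S A) : Prop :=
  ∃ φ : SuperAut S A ev od, ∀ g, (comp g).map φ.e.toLinearMap = comp' g

/-- `Δ` refines `Γ`. -/
def Refines (Δ : H → Submodule S A) (Γ : G → Submodule S A) : Prop :=
  ∀ h, Δ h ≠ ⊥ → ∃ g, Δ h ≤ Γ g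

/-- Equivalence of a `G`-grading and an `H`-grading on a superalgebra. -/
def GradEquiv (ev od : Submodule S A) (Γ : G → Submodule S A)
    (Δ : H → Submodule S A) : Prop :=
  ∃ φ : SuperAut S A ev od, ∃ α : {g : G // Γ g ≠ ⊥} → {h : H // Δ h ≠ ⊥},
    Function.Bijective α ∧
    ∀ g : {g : G // Γ g ≠ ⊥}, (Γ g.1).map φ.e.toLinearMap = Δ (α g).1

/-- A grading is fine if any grading refining it has the same nonzero
homogeneous components. -/
def IsFine (ev od : Submodule S A) (Γ : G → Submodule S A) : Prop :=
  ∀ (H : Type) (_ : CommGroup H) (Δ : H → Submodule S A),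
    IsSuperGrading ev od Δ → Refines Δ Γ →
      {p : Submodule S A | p ≠ ⊥ ∧ ∃ h, Δ h = p} =
      {p : Submodule S A | p ≠ ⊥ ∧ ∃ g, Γ g = p}

end Gradings

/-! ### SL₂ and the semidirect product with C₂ -/

abbrev SL2 (R : Type) [CommRing R] := Matrix.SpecialLinearGroup (Fin 2) R

def swapAut (M : Type) [Monoid M] : MulAut (M × M) := MulEquiv.prodComm

lemma swapAut_sq (M : Type) [Monoid M] : swapAut M * swapAut M = 1 :=
  MulEquiv.ext fun _ => rfl

/-- The action of `C₂ = Multiplicative (ZMod 2)` on `M × M` by swapping the factors. -/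
def swapHom (M : Type) [Group M] : Multiplicative (ZMod 2) →* MulAut (M × M) :=
  MonoidHom.mk' (fun c => if c.toAdd = 0 then 1 else swapAut M) (by
    intro a b
    have key : ∀ c : Multiplicative (ZMod 2),
        c = Multiplicative.ofAdd 0 ∨ c = Multiplicative.ofAdd 1 := by decide
    rcases key a with rfl | rfl <;> rcases key b with rfl | rfl <;>
      simp [← ofAdd_add, swapAut_sq] <;> exact fun h => absurd (by decide) h)

end Kac
/-! ### The (base-changed) Kaplansky superalgebra `K₃ ⊗ R` -/

namespace Kac

section Algebras

variable (F : Type) [Field F] (R : Type) [CommRing R] [Algebra F R]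

/-- Coordinates: `0 ↦ a`, `1 ↦ u`, `2 ↦ v`. -/
def K3A (F : Type) [Field F] (R : Type) [CommRing R] [Algebra F R] : Type := Fin 3 → R

instance : AddCommGroup (K3A F R) := Pi.addCommGroup
instance (S : Type) [Semiring S] [Module S R] : Module S (K3A F R) := Pi.module _ _ _

namespace K3A
variable {F R}

def mulFun (x y : K3A F R) : K3A F R := fun i =>
  match i with
  | ⟨0, _⟩ => x 0 * y 0 + (x 1 * y 2 - x 2 * y 1)
  | ⟨1, _⟩ => algebraMap F R 2⁻¹ * (x 0 * y 1 + y 0 * x 1)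
  | ⟨2, _⟩ => algebraMap F R 2⁻¹ * (x 0 * y 2 + y 0 * x 2)

instance : Mul (K3A F R) := ⟨mulFun⟩

lemma mul_def (x y : K3A F R) : x * y = mulFun x y := rfl

@[simp] lemma add_apply (x y : K3A F R) (i : Fin 3) : (x + y) i = x i + y i := rfl
@[simp] lemma sub_apply (x y : K3A F R) (i : Fin 3) : (x - y) i = x i - y i := rfl
@[simp] lemma neg_apply (x : K3A F R) (i : Fin 3) : (-x) i = -(x i) := rfl
@[simp] lemma zero_apply (i : Fin 3) : (0 : K3A F R) i = 0 := rfl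
@[simp] lemma smul_apply (S : Type) [Semiring S] [Module S R] (c : S) (x : K3A F R) (i : Fin 3) :
    (c • x) i = c • (x i) := rfl

variable (F R)

/-- The even part `R·a`. -/
def even (S : Type) [Semiring S] [Module S R] : Submodule S (K3A F R) := stdSub S R 3 {0}
/-- The odd part `W ⊗ R`. -/
def odd (S : Type) [Semiring S] [Module S R] : Submodule S (K3A F R) := stdSub S R 3 {1, 2}

/-- The element `a`. -/
def aE : K3A F R := ![1, 0, 0]
/-- The element of `W ⊗ R` with coordinates `w` in the symplectic basis `{u, v}`. -/
def wE (w : Fin 2 → R) : K3A F R := ![0, w 0, w 1]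

end K3A

/-- `J(W) ⊗ R`; coordinates: `0 ↦ 1`, `1 ↦ u`, `2 ↦ v`. -/
def JW1A (R : Type) [CommRing R] : Type := Fin 3 → R

instance : AddCommGroup (JW1A R) := Pi.addCommGroup
instance (S : Type) [Semiring S] [Module S R] : Module S (JW1A R) := Pi.module _ _ _

namespace JW1A
variable {R}

def mulFun (x y : JW1A R) : JW1A R := fun i =>
  match i with
  | ⟨0, _⟩ => x 0 * y 0 + (x 1 * y 2 - x 2 * y 1)
  | ⟨1, _⟩ => x 0 * y 1 + y 0 * x 1
  | ⟨2, _⟩ => x 0 * y 2 + y 0 * x 2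

instance : Mul (JW1A R) := ⟨mulFun⟩

lemma mul_def (x y : JW1A R) : x * y = mulFun x y := rfl

@[simp] lemma add_apply (x y : JW1A R) (i : Fin 3) : (x + y) i = x i + y i := rfl
@[simp] lemma sub_apply (x y : JW1A R) (i : Fin 3) : (x - y) i = x i - y i := rfl
@[simp] lemma neg_apply (x : JW1A R) (i : Fin 3) : (-x) i = -(x i) := rfl
@[simp] lemma zero_apply (i : Fin 3) : (0 : JW1A R) i = 0 := rfl
@[simp] lemma smul_apply (S : Type) [Semiring S] [Module S R] (c : S) (x : JW1A R) (i : Fin 3) :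
    (c • x) i = c • (x i) := rfl

variable (R)

def even (S : Type) [Semiring S] [Module S R] : Submodule S (JW1A R) := stdSub S R 3 {0}
def odd (S : Type) [Semiring S] [Module S R] : Submodule S (JW1A R) := stdSub S R 3 {1, 2}

def oneE : JW1A R := ![1, 0, 0]
def wE (w : Fin 2 → R) : JW1A R := ![0, w 0, w 1]

end JW1A

/-- `(K₃ × K₃) ⊗ R`; coordinates `0,1,2` for the first copy (`a,u,v`),
`3,4,5` for the second copy. -/
def K33A (F : Type) [Field F] (R : Type) [CommRing R] [Algebra F R] : Type := Fin 6 → R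

instance : AddCommGroup (K33A F R) := Pi.addCommGroup
instance (S : Type) [Semiring S] [Module S R] : Module S (K33A F R) := Pi.module _ _ _

namespace K33A
variable {F R}

def mulFun (x y : K33A F R) : K33A F R := fun i =>
  match i with
  | ⟨0, _⟩ => x 0 * y 0 + (x 1 * y 2 - x 2 * y 1)
  | ⟨1, _⟩ => algebraMap F R 2⁻¹ * (x 0 * y 1 + y 0 * x 1)
  | ⟨2, _⟩ => algebraMap F R 2⁻¹ * (x 0 * y 2 + y 0 * x 2)
  | ⟨3, _⟩ => x 3 * y 3 + (x 4 * y 5 - x 5 * y 4)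
  | ⟨4, _⟩ => algebraMap F R 2⁻¹ * (x 3 * y 4 + y 3 * x 4)
  | ⟨5, _⟩ => algebraMap F R 2⁻¹ * (x 3 * y 5 + y 3 * x 5)

instance : Mul (K33A F R) := ⟨mulFun⟩

lemma mul_def (x y : K33A F R) : x * y = mulFun x y := rfl

@[simp] lemma add_apply (x y : K33A F R) (i : Fin 6) : (x + y) i = x i + y i := rfl
@[simp] lemma sub_apply (x y : K33A F R) (i : Fin 6) : (x - y) i = x i - y i := rfl
@[simp] lemma neg_apply (x : K33A F R) (i : Fin 6) : (-x) i = -(x i) := rfl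
@[simp] lemma zero_apply (i : Fin 6) : (0 : K33A F R) i = 0 := rfl
@[simp] lemma smul_apply (S : Type) [Semiring S] [Module S R] (c : S) (x : K33A F R) (i : Fin 6) :
    (c • x) i = c • (x i) := rfl

variable (F R)

def even (S : Type) [Semiring S] [Module S R] : Submodule S (K33A F R) := stdSub S R 6 {0, 3}
def odd (S : Type) [Semiring S] [Module S R] : Submodule S (K33A F R) := stdSub S R 6 {1, 2, 4, 5}

/-- The element `(a, 0)`. -/
def aLeft : K33A F R := ![1, 0, 0, 0, 0, 0]
/-- The element `(0, a)`. -/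
def aRight : K33A F R := ![0, 0, 0, 1, 0, 0]
/-- The element `(v, w)` of the odd part, `v, w ∈ W ⊗ R`. -/
def oddE (w w' : Fin 2 → R) : K33A F R := ![0, w 0, w 1, 0, w' 0, w' 1]
/-- The exchange automorphism `(x, y) ↦ (y, x)`. -/
def swapFun (x : K33A F R) : K33A F R := fun i =>
  match i with
  | ⟨0, _⟩ => x 3
  | ⟨1, _⟩ => x 4
  | ⟨2, _⟩ => x 5
  | ⟨3, _⟩ => x 0
  | ⟨4, _⟩ => x 1
  | ⟨5, _⟩ => x 2

end K33A

/-- `(J(W) × J(W)) ⊗ R`. -/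
def JW2A (R : Type) [CommRing R] : Type := Fin 6 → R

instance : AddCommGroup (JW2A R) := Pi.addCommGroup
instance (S : Type) [Semiring S] [Module S R] : Module S (JW2A R) := Pi.module _ _ _

namespace JW2A
variable {R}

def mulFun (x y : JW2A R) : JW2A R := fun i =>
  match i with
  | ⟨0, _⟩ => x 0 * y 0 + (x 1 * y 2 - x 2 * y 1)
  | ⟨1, _⟩ => x 0 * y 1 + y 0 * x 1
  | ⟨2, _⟩ => x 0 * y 2 + y 0 * x 2
  | ⟨3, _⟩ => x 3 * y 3 + (x 4 * y 5 - x 5 * y 4)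
  | ⟨4, _⟩ => x 3 * y 4 + y 3 * x 4
  | ⟨5, _⟩ => x 3 * y 5 + y 3 * x 5

instance : Mul (JW2A R) := ⟨mulFun⟩

lemma mul_def (x y : JW2A R) : x * y = mulFun x y := rfl

@[simp] lemma add_apply (x y : JW2A R) (i : Fin 6) : (x + y) i = x i + y i := rfl
@[simp] lemma sub_apply (x y : JW2A R) (i : Fin 6) : (x - y) i = x i - y i := rfl
@[simp] lemma neg_apply (x : JW2A R) (i : Fin 6) : (-x) i = -(x i) := rfl
@[simp] lemma zero_apply (i : Fin 6) : (0 : JW2A R) i = 0 := rfl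
@[simp] lemma smul_apply (S : Type) [Semiring S] [Module S R] (c : S) (x : JW2A R) (i : Fin 6) :
    (c • x) i = c • (x i) := rfl

variable (R)

def even (S : Type) [Semiring S] [Module S R] : Submodule S (JW2A R) := stdSub S R 6 {0, 3}
def odd (S : Type) [Semiring S] [Module S R] : Submodule S (JW2A R) := stdSub S R 6 {1, 2, 4, 5}

/-- The element `(1, 0)`. -/
def oneLeft : JW2A R := ![1, 0, 0, 0, 0, 0]
/-- The element `(0, 1)`. -/
def oneRight : JW2A R := ![0, 0, 0, 1, 0, 0]
def oddE (w w' : Fin 2 → R) : JW2A R := ![0, w 0, w 1, 0, w' 0, w' 1]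
def swapFun (x : JW2A R) : JW2A R := fun i =>
  match i with
  | ⟨0, _⟩ => x 3
  | ⟨1, _⟩ => x 4
  | ⟨2, _⟩ => x 5
  | ⟨3, _⟩ => x 0
  | ⟨4, _⟩ => x 1
  | ⟨5, _⟩ => x 2

end JW2A

/-- Kac's superalgebra `K₁₀ ⊗ R`.  CoordinatesL `0 ↦ 1`, `1 ↦ a⊗a`,
`2 ↦ u⊗u`, `3 ↦ u⊗v`, `4 ↦ v⊗u`, `5 ↦ v⊗v`, `6 ↦ u⊗a`, `7 ↦ v⊗a`,
`8 ↦ a⊗u`, `9 ↦ a⊗v`. -/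
def K10A (F : Type) [Field F] (R : Type) [CommRing R] [Algebra F R] : Type := Fin 10 → R

instance : AddCommGroup (K10A F R) := Pi.addCommGroup
instance (S : Type) [Semiring S] [Module S R] : Module S (K10A F R) := Pi.module _ _ _

namespace K10A
variable {F R}

def mulFun (x y : K10A F R) : K10A F R := fun i =>
  match i with
  | ⟨0, _⟩ => x 0 * y 0 - algebraMap F R (3/16) * (x 1 * y 1)
      + algebraMap F R (3/4) * (x 2 * y 5 + x 5 * y 2 - x 3 * y 4 - x 4 * y 3)
      - algebraMap F R (3/8) * (x 6 * y 7 - x 7 * y 6 + x 8 * y 9 - x 9 * y 8)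
  | ⟨1, _⟩ => x 0 * y 1 + x 1 * y 0 + x 1 * y 1
      - (x 2 * y 5 + x 5 * y 2 - x 3 * y 4 - x 4 * y 3)
      + (x 6 * y 7 - x 7 * y 6) + (x 8 * y 9 - x 9 * y 8)
  | ⟨2, _⟩ => x 0 * y 2 + x 2 * y 0 + algebraMap F R 4⁻¹ * (x 1 * y 2 + x 2 * y 1)
      + algebraMap F R 4⁻¹ * (x 6 * y 8 - x 8 * y 6)
  | ⟨3, _⟩ => x 0 * y 3 + x 3 * y 0 + algebraMap F R 4⁻¹ * (x 1 * y 3 + x 3 * y 1)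
      + algebraMap F R 4⁻¹ * (x 6 * y 9 - x 9 * y 6)
  | ⟨4, _⟩ => x 0 * y 4 + x 4 * y 0 + algebraMap F R 4⁻¹ * (x 1 * y 4 + x 4 * y 1)
      + algebraMap F R 4⁻¹ * (x 7 * y 8 - x 8 * y 7)
  | ⟨5, _⟩ => x 0 * y 5 + x 5 * y 0 + algebraMap F R 4⁻¹ * (x 1 * y 5 + x 5 * y 1)
      + algebraMap F R 4⁻¹ * (x 7 * y 9 - x 9 * y 7)
  | ⟨6, _⟩ => x 0 * y 6 + x 6 * y 0 + algebraMap F R 2⁻¹ * (x 1 * y 6 + x 6 * y 1)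
      + algebraMap F R 2⁻¹ * (x 2 * y 9 + x 9 * y 2) - algebraMap F R 2⁻¹ * (x 3 * y 8 + x 8 * y 3)
  | ⟨7, _⟩ => x 0 * y 7 + x 7 * y 0 + algebraMap F R 2⁻¹ * (x 1 * y 7 + x 7 * y 1)
      + algebraMap F R 2⁻¹ * (x 4 * y 9 + x 9 * y 4) - algebraMap F R 2⁻¹ * (x 5 * y 8 + x 8 * y 5)
  | ⟨8, _⟩ => x 0 * y 8 + x 8 * y 0 + algebraMap F R 2⁻¹ * (x 1 * y 8 + x 8 * y 1)
      - algebraMap F R 2⁻¹ * (x 2 * y 7 + x 7 * y 2) + algebraMap F R 2⁻¹ * (x 4 * y 6 + x 6 * y 4)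
  | ⟨9, _⟩ => x 0 * y 9 + x 9 * y 0 + algebraMap F R 2⁻¹ * (x 1 * y 9 + x 9 * y 1)
      - algebraMap F R 2⁻¹ * (x 3 * y 7 + x 7 * y 3) + algebraMap F R 2⁻¹ * (x 5 * y 6 + x 6 * y 5)

instance : Mul (K10A F R) := ⟨mulFun⟩

lemma mul_def (x y : K10A F R) : x * y = mulFun x y := rfl

@[simp] lemma add_apply (x y : K10A F R) (i : Fin 10) : (x + y) i = x i + y i := rfl
@[simp] lemma sub_apply (x y : K10A F R) (i : Fin 10) : (x - y) i = x i - y i := rfl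
@[simp] lemma neg_apply (x : K10A F R) (i : Fin 10) : (-x) i = -(x i) := rfl
@[simp] lemma zero_apply (i : Fin 10) : (0 : K10A F R) i = 0 := rfl
@[simp] lemma smul_apply (S : Type) [Semiring S] [Module S R] (c : S) (x : K10A F R) (i : Fin 10) :
    (c • x) i = c • (x i) := rfl

variable (F R)

def even (S : Type) [Semiring S] [Module S R] : Submodule S (K10A F R) :=
  stdSub S R 10 {0, 1, 2, 3, 4, 5}
def odd (S : Type) [Semiring S] [Module S R] : Submodule S (K10A F R) :=
  stdSub S R 10 {6, 7, 8, 9}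

/-- The unity `1`. -/
def oneE : K10A F R := ![1, 0, 0, 0, 0, 0, 0, 0, 0, 0]
/-- The element `a ⊗ a`. -/
def aaE : K10A F R := ![0, 1, 0, 0, 0, 0, 0, 0, 0, 0]
/-- The element `v ⊗ w ∈ W ⊗ W`. -/
def wwE (w w' : Fin 2 → R) : K10A F R :=
  ![0, 0, w 0 * w' 0, w 0 * w' 1, w 1 * w' 0, w 1 * w' 1, 0, 0, 0, 0]
/-- The element `w ⊗ a`, `w ∈ W ⊗ R`. -/
def waE (w : Fin 2 → R) : K10A F R := ![0, 0, 0, 0, 0, 0, w 0, w 1, 0, 0]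
/-- The element `a ⊗ w`, `w ∈ W ⊗ R`. -/
def awE (w : Fin 2 → R) : K10A F R := ![0, 0, 0, 0, 0, 0, 0, 0, w 0, w 1]
/-- The exchange automorphism `τ`, `τ(x ⊗ y) = (-1)^{|x||y|} y ⊗ x`. -/
def tauFun (x : K10A F R) : K10A F R := fun i =>
  match i with
  | ⟨0, _⟩ => x 0
  | ⟨1, _⟩ => x 1
  | ⟨2, _⟩ => -x 2
  | ⟨3, _⟩ => -x 4
  | ⟨4, _⟩ => -x 3
  | ⟨5, _⟩ => -x 5
  | ⟨6, _⟩ => x 8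
  | ⟨7, _⟩ => x 9
  | ⟨8, _⟩ => x 6
  | ⟨9, _⟩ => x 7

end K10A

end Algebras

end Kac

namespace Kac
namespace K10A

variable {F : Type} [Field F] {R : Type} [CommRing R] [Algebra F R]

instance : NonUnitalNonAssocRing (K10A F R) where
  __ := (inferInstance : AddCommGroup (K10A F R))
  __ := (inferInstance : Mul (K10A F R))
  left_distrib x y z := by
    show mulFun x (y + z) = mulFun x y + mulFun x z
    funext i; fin_cases i <;> (simp only [mulFun, add_apply]; ring)
  right_distrib x y z := by
    show mulFun (x + y) z = mulFun x z + mulFun y z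
    funext i; fin_cases i <;> (simp only [mulFun, add_apply]; ring)
  zero_mul x := by
    show mulFun 0 x = 0
    funext i; fin_cases i <;> (simp only [mulFun, zero_apply]; ring)
  mul_zero x := by
    show mulFun x 0 = 0
    funext i; fin_cases i <;> (simp only [mulFun, zero_apply]; ring)

instance (S : Type) [CommSemiring S] [Algebra S R] :
    SMulCommClass S (K10A F R) (K10A F R) where
  smul_comm c x y := by
    show c • mulFun x y = mulFun x (c • y)
    funext i; fin_cases i <;>
      (simp only [mulFun, smul_apply, Algebra.smul_def]; ring)

instance (S : Type) [CommSemiring S] [Algebra S R] :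
    IsScalarTower S (K10A F R) (K10A F R) where
  smul_assoc c x y := by
    show mulFun (c • x) y = c • mulFun x y
    funext i; fin_cases i <;>
      (simp only [mulFun, smul_apply, Algebra.smul_def]; ring)

end K10A
end Kac

namespace Kac
namespace K10A

section Tau

variable {F : Type} [Field F] {K : Type} [Field K] [Algebra F K]

/-- The map `τ ⊗ σ` on `K₁₀ ⊗_F K` (realized as `K10A F K`). -/
def tauSigmaFun (σ : K ≃ₐ[F] K) (x : K10A F K) : K10A F K := fun i =>
  match i with
  | ⟨0, _⟩ => σ (x 0)
  | ⟨1, _⟩ => σ (x 1)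
  | ⟨2, _⟩ => -σ (x 2)
  | ⟨3, _⟩ => -σ (x 4)
  | ⟨4, _⟩ => -σ (x 3)
  | ⟨5, _⟩ => -σ (x 5)
  | ⟨6, _⟩ => σ (x 8)
  | ⟨7, _⟩ => σ (x 9)
  | ⟨8, _⟩ => σ (x 6)
  | ⟨9, _⟩ => σ (x 7)

variable (σ : K ≃ₐ[F] K)

lemma tauSigmaFun_add (x y : K10A F K) :
    tauSigmaFun σ (x + y) = tauSigmaFun σ x + tauSigmaFun σ y := by
  funext i; fin_cases i <;> (simp [tauSigmaFun]; try ring)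

lemma tauSigmaFun_smul (c : F) (x : K10A F K) :
    tauSigmaFun σ (c • x) = c • tauSigmaFun σ x := by
  funext i; fin_cases i <;> (simp [tauSigmaFun, Algebra.smul_def, map_mul, AlgEquiv.commutes]; try ring)

lemma tauSigmaFun_mul (x y : K10A F K) :
    tauSigmaFun σ (x * y) = tauSigmaFun σ x * tauSigmaFun σ y := by
  funext i; fin_cases i <;>
    (simp only [tauSigmaFun, mul_def, mulFun, map_add, map_sub, map_mul, map_neg,
      AlgEquiv.commutes]; ring)

/-- Galois descent: the `F`-form `K₁₀,K = {X ∈ K₁₀ ⊗ K : (τ⊗σ)(X) = X}`. -/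
def fixedK10 : Submodule F (K10A F K) where
  carrier := {x | tauSigmaFun σ x = x}
  add_mem' {a b} ha hb := by
    show tauSigmaFun σ (a + b) = a + b
    rw [tauSigmaFun_add, Set.mem_setOf_eq.mp ha, Set.mem_setOf_eq.mp hb]
  zero_mem' := by
    show tauSigmaFun σ 0 = 0
    funext i; fin_cases i <;> (simp [tauSigmaFun]; try ring)
  smul_mem' c x hx := by
    show tauSigmaFun σ (c • x) = c • x
    rw [tauSigmaFun_smul, Set.mem_setOf_eq.mp hx]

lemma mem_fixedK10 {x : K10A F K} : x ∈ fixedK10 σ ↔ tauSigmaFun σ x = x := Iff.rfl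

instance : Mul ↥(fixedK10 σ) :=
  ⟨fun x y => ⟨x.1 * y.1, by
    have hx : tauSigmaFun σ x.1 = x.1 := x.2
    have hy : tauSigmaFun σ y.1 = y.1 := y.2
    show tauSigmaFun σ (x.1 * y.1) = x.1 * y.1
    rw [tauSigmaFun_mul, hx, hy]⟩⟩

@[simp] lemma coe_mul (x y : ↥(fixedK10 σ)) : ((x * y : ↥(fixedK10 σ)) : K10A F K) = x.1 * y.1 :=
  rfl

instance : NonUnitalNonAssocRing ↥(fixedK10 σ) where
  __ := (inferInstance : AddCommGroup ↥(fixedK10 σ))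
  __ := (inferInstance : Mul ↥(fixedK10 σ))
  left_distrib x y z := Subtype.ext (left_distrib x.1 y.1 z.1)
  right_distrib x y z := Subtype.ext (right_distrib x.1 y.1 z.1)
  zero_mul x := Subtype.ext (zero_mul x.1)
  mul_zero x := Subtype.ext (mul_zero x.1)

instance : SMulCommClass F ↥(fixedK10 σ) ↥(fixedK10 σ) :=
  ⟨fun c x y => Subtype.ext (smul_comm c x.1 y.1)⟩

instance : IsScalarTower F ↥(fixedK10 σ) ↥(fixedK10 σ) :=
  ⟨fun c x y => Subtype.ext (smul_assoc c x.1 y.1)⟩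

/-- The even part of `K₁₀,K`, as an `F`-submodule. -/
def fixedEven : Submodule F ↥(fixedK10 σ) := (even F K F).comap (fixedK10 σ).subtype
/-- The odd part of `K₁₀,K`, as an `F`-submodule. -/
def fixedOdd : Submodule F ↥(fixedK10 σ) := (odd F K F).comap (fixedK10 σ).subtype

end Tau

end K10A
end Kac

namespace Kac
namespace K10A

section OddElements

variable {F : Type} [Field F] {R : Type} [CommRing R] [Algebra F R]

/-- The odd element with the given coordinates. -/
def oddE (a b c d : R) : K10A F R := ![0, 0, 0, 0, 0, 0, a, b, c, d]

variable (a b c d : R)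

@[simp] lemma oddE_zero : (oddE a b c d : K10A F R) 0 = 0 := rfl
@[simp] lemma oddE_one : (oddE a b c d : K10A F R) 1 = 0 := rfl
@[simp] lemma oddE_two : (oddE a b c d : K10A F R) 2 = 0 := rfl
@[simp] lemma oddE_three : (oddE a b c d : K10A F R) 3 = 0 := rfl
@[simp] lemma oddE_four : (oddE a b c d : K10A F R) 4 = 0 := rfl
@[simp] lemma oddE_five : (oddE a b c d : K10A F R) 5 = 0 := rfl
@[simp] lemma oddE_six : (oddE a b c d : K10A F R) 6 = a := rfl
@[simp] lemma oddE_seven : (oddE a b c d : K10A F R) 7 = b := rfl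
@[simp] lemma oddE_eight : (oddE a b c d : K10A F R) 8 = c := rfl
@[simp] lemma oddE_nine : (oddE a b c d : K10A F R) 9 = d := rfl

lemma oddE_mem_odd (S : Type) [Semiring S] [Module S R] :
    (oddE a b c d : K10A F R) ∈ odd F R S := by
  intro i hi
  fin_cases i <;> simp_all

lemma eq_oddE_of_mem_odd {S : Type} [Semiring S] [Module S R] {x : K10A F R}
    (hx : x ∈ odd F R S) : x = oddE (x 6) (x 7) (x 8) (x 9) := by
  have hx0 (j : Fin 10) (hj : j ∉ ({6, 7, 8, 9} : Set (Fin 10))) : x j = 0 := hx j hj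
  funext i
  fin_cases i <;> simp [hx0]

end OddElements

section Descent

variable {F : Type} [Field F] {K : Type} [Field K] [Algebra F K] (σ : K ≃ₐ[F] K)

lemma tauSigmaFun_smul_scalar (c : K) (x : K10A F K) :
    tauSigmaFun σ (c • x) = σ c • tauSigmaFun σ x := by
  funext i; fin_cases i <;> simp [tauSigmaFun]

lemma fixedK10_eq_even_sup_odd :
    fixedK10 σ = (fixedK10 σ ⊓ even F K F) ⊔ (fixedK10 σ ⊓ odd F K F) := by
  refine le_antisymm (fun x hx => ?_) (sup_le inf_le_left inf_le_left)
  have h (i : Fin 10) : tauSigmaFun σ x i = x i := congrFun hx i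
  rw [Submodule.mem_sup]
  refine ⟨fun i => if i < 6 then x i else 0, ⟨?_, ?_⟩,
    fun i => if i < 6 then 0 else x i, ⟨?_, ?_⟩, ?_⟩
  · funext i
    have := h i
    fin_cases i <;> simp_all [tauSigmaFun]
  · intro i hi
    fin_cases i <;> simp_all
  · funext i
    have := h i
    fin_cases i <;> simp_all [tauSigmaFun]
  · intro i hi
    fin_cases i <;> simp_all
  · funext i
    change (if i < 6 then x i else 0) + (if i < 6 then 0 else x i) = x i
    split_ifs <;> simp

variable {σ}

lemma tauSigmaFun_tauSigmaFun (hσ2 : ∀ k, σ (σ k) = k) (x : K10A F K) :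
    tauSigmaFun σ (tauSigmaFun σ x) = x := by
  funext i; fin_cases i <;> simp [tauSigmaFun, hσ2]

/-- The trace of `X` under the action of the Galois group by `τ ⊗ σ`. -/
lemma add_tauSigmaFun_mem (hσ2 : ∀ k, σ (σ k) = k) (x : K10A F K) :
    x + tauSigmaFun σ x ∈ fixedK10 σ := by
  rw [mem_fixedK10, tauSigmaFun_add, tauSigmaFun_tauSigmaFun hσ2, add_comm]

lemma tauSigmaFun_mem_even {x : K10A F K} (hx : x ∈ even F K K) :
    tauSigmaFun σ x ∈ even F K K := by
  intro i hi
  have h (j : Fin 10) (hj : j ∉ ({0, 1, 2, 3, 4, 5} : Set (Fin 10))) : x j = 0 := hx j hj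
  fin_cases i <;> simp_all [tauSigmaFun]

lemma tauSigmaFun_mem_odd {x : K10A F K} (hx : x ∈ odd F K K) :
    tauSigmaFun σ x ∈ odd F K K := by
  intro i hi
  have h (j : Fin 10) (hj : j ∉ ({6, 7, 8, 9} : Set (Fin 10))) : x j = 0 := hx j hj
  fin_cases i <;> simp_all [tauSigmaFun]

variable (σ)

instance : IsScalarTower F K (K10A F K) :=
  ⟨fun a b x => funext fun i => smul_assoc a b (x i)⟩

/-- The multiplication map `K ⊗ K₁₀,K → K₁₀ ⊗ K`. -/
def descentMap : K ⊗[F] ↥(fixedK10 σ) →ₗ[K] K10A F K :=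
  TensorProduct.AlgebraTensorModule.lift
    (LinearMap.toSpanSingleton K (↥(fixedK10 σ) →ₗ[F] K10A F K) (fixedK10 σ).subtype)

@[simp] lemma descentMap_tmul (k : K) (x : ↥(fixedK10 σ)) :
    descentMap σ (k ⊗ₜ x) = k • (x : K10A F K) := by
  simp [descentMap]

lemma descentMap_mul (x y : K ⊗[F] ↥(fixedK10 σ)) :
    descentMap σ (x * y) = descentMap σ x * descentMap σ y := by
  induction x with
  | zero => simp
  | add a b ha hb => rw [add_mul, map_add, map_add, add_mul, ha, hb]
  | tmul k a =>
    induction y with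
    | zero => simp
    | add c d hc hd => rw [mul_add, map_add, map_add, mul_add, hc, hd]
    | tmul l b =>
      rw [Algebra.TensorProduct.tmul_mul_tmul, descentMap_tmul, descentMap_tmul, descentMap_tmul,
        coe_mul, smul_mul_smul_comm]

variable {σ}

lemma map_descentMap_baseChange (hσ2 : ∀ k, σ (σ k) = k) {κ : K} (hκ : σ κ ≠ κ)
    (p : Submodule K (K10A F K)) (hp : ∀ x ∈ p, tauSigmaFun σ x ∈ p)
    (q : Submodule F ↥(fixedK10 σ)) (hq : ∀ x, x ∈ q ↔ (x : K10A F K) ∈ p) :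
    (q.baseChange K).map (descentMap σ) = p := by
  apply le_antisymm
  · rw [Submodule.baseChange_eq_span, Submodule.map_span_le]
    rintro _ ⟨x, hx, rfl⟩
    simpa using (hq x).1 hx
  · intro x hx
    have hx' := p.smul_mem κ hx
    let s : ↥(fixedK10 σ) := ⟨_, add_tauSigmaFun_mem hσ2 x⟩
    let t : ↥(fixedK10 σ) := ⟨_, add_tauSigmaFun_mem hσ2 (κ • x)⟩
    have hs : s ∈ q := (hq s).2 (p.add_mem hx (hp x hx))
    have ht : t ∈ q := (hq t).2 (p.add_mem hx' (hp _ hx'))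
    refine ⟨(κ - σ κ)⁻¹ • ((1 : K) ⊗ₜ t - σ κ ⊗ₜ s), ?_, ?_⟩
    · exact Submodule.smul_mem _ _ (Submodule.sub_mem _
        (Submodule.tmul_mem_baseChange_of_mem _ ht) (Submodule.tmul_mem_baseChange_of_mem _ hs))
    · rw [map_smul, map_sub, descentMap_tmul, descentMap_tmul,
        inv_smul_eq_iff₀ (sub_ne_zero.2 hκ.symm)]
      simp only [s, t, tauSigmaFun_smul_scalar]
      module

lemma descentMap_surjective (hσ2 : ∀ k, σ (σ k) = k) {κ : K} (hκ : σ κ ≠ κ) :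
    Function.Surjective (descentMap σ) := by
  intro x
  have h := map_descentMap_baseChange hσ2 hκ ⊤ (fun _ _ => trivial) ⊤ (fun _ => by simp)
  obtain ⟨y, -, hy⟩ := h.ge (Submodule.mem_top (x := x))
  exact ⟨y, hy⟩

lemma span_one_eq_top_of_not_fixed (hquad : Module.finrank F K = 2) {κ : K} (hκ : σ κ ≠ κ) :
    Submodule.span F {κ, 1} = ⊤ := by
  have hli : LinearIndependent F ![1, κ] := by
    rw [LinearIndependent.pair_iff]
    intro a b h
    have h' := congrArg σ h
    simp only [Algebra.smul_def, map_add, map_mul, map_one, AlgEquiv.commutes, map_zero] at h h'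
    have hb : algebraMap F K b * (σ κ - κ) = 0 := by linear_combination h' - h
    have hb0 : b = 0 := by simpa [sub_ne_zero.2 hκ] using hb
    subst hb0
    exact ⟨by simpa using h, rfl⟩
  have : FiniteDimensional F K := Module.finite_of_finrank_eq_succ hquad
  simpa using hli.span_eq_top_of_card_eq_finrank' (by simp [hquad])

lemma descentMap_injective (hquad : Module.finrank F K = 2) {κ : K} (hκ : σ κ ≠ κ) :
    Function.Injective (descentMap σ) := by
  have hspan (x : K ⊗[F] ↥(fixedK10 σ)) :
      ∃ a b : ↥(fixedK10 σ), x = (1 : K) ⊗ₜ a + κ ⊗ₜ b := by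
    induction x with
    | zero => exact ⟨0, 0, by simp⟩
    | add x y hx hy =>
      obtain ⟨a, b, rfl⟩ := hx
      obtain ⟨c, d, rfl⟩ := hy
      exact ⟨a + c, b + d, by simp only [TensorProduct.tmul_add]; abel⟩
    | tmul k x =>
      have hk : k ∈ Submodule.span F {κ, 1} := by
        rw [span_one_eq_top_of_not_fixed hquad hκ]; trivial
      obtain ⟨c, d, rfl⟩ := Submodule.mem_span_pair.1 hk
      exact ⟨d • x, c • x, by
        rw [TensorProduct.add_tmul, TensorProduct.smul_tmul, TensorProduct.smul_tmul, add_comm]⟩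
  rw [injective_iff_map_eq_zero]
  intro x hx
  obtain ⟨a, b, rfl⟩ := hspan x
  rw [map_add, descentMap_tmul, descentMap_tmul, one_smul] at hx
  have hx' := congrArg (tauSigmaFun σ) hx
  rw [tauSigmaFun_add, tauSigmaFun_smul_scalar, (mem_fixedK10 σ).1 a.2, (mem_fixedK10 σ).1 b.2,
    (mem_fixedK10 σ).1 (fixedK10 σ).zero_mem] at hx'
  have hb : (σ κ - κ) • (b : K10A F K) = 0 := by
    rw [sub_smul, sub_eq_zero]
    exact add_left_cancel (hx'.trans hx.symm)
  have hb0 : (b : K10A F K) = 0 := (smul_eq_zero.1 hb).resolve_left (sub_ne_zero.2 hκ)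
  rw [hb0, smul_zero, add_zero] at hx
  have ha : a = 0 := Subtype.ext hx
  have hb' : b = 0 := Subtype.ext hb0
  simp [ha, hb']

/-- In a nonsplit form a product of two odd elements never acts on the odd part as `1/8`. -/
lemma not_odd_mul_odd_acts_as_scalar (hchar : (2 : F) ≠ 0) (hσ2 : ∀ k, σ (σ k) = k)
    {κ : K} (hκ : σ κ ≠ κ) {x y : K10A F K}
    (hx : x ∈ fixedK10 σ) (hxo : x ∈ odd F K F) (hyo : y ∈ odd F K F)
    (h : ∀ z ∈ fixedK10 σ, z ∈ odd F K F → (x * y) * z = (8⁻¹ : F) • z) : False := by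
  have h2 : (2 : K) ≠ 0 := by
    simpa only [map_ofNat, map_zero] using (algebraMap F K).injective.ne hchar
  have h4 : (4 : K) ≠ 0 := by
    rw [show (4 : K) = 2 ^ 2 by norm_num]; exact pow_ne_zero _ h2
  have h8 : (8 : K) ≠ 0 := by
    rw [show (8 : K) = 2 ^ 3 by norm_num]; exact pow_ne_zero _ h2
  have hx6 : σ (x 8) = x 6 := congrFun hx 6
  have hx7 : σ (x 9) = x 7 := congrFun hx 7
  have hx8 : σ (x 6) = x 8 := congrFun hx 8
  have hx9 : σ (x 7) = x 9 := congrFun hx 9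
  have hxe := eq_oddE_of_mem_odd hxo
  have hye := eq_oddE_of_mem_odd hyo
  have P0 : (x * y) 0 = -(3 / 8) * (x 6 * y 7 - x 7 * y 6 + x 8 * y 9 - x 9 * y 8) := by
    rw [hxe, hye]; simp [mul_def, mulFun, map_ofNat]
  have P1 : (x * y) 1 = x 6 * y 7 - x 7 * y 6 + x 8 * y 9 - x 9 * y 8 := by
    rw [hxe, hye]; simp [mul_def, mulFun]; ring
  have P2 : (x * y) 2 = 4⁻¹ * (x 6 * y 8 - x 8 * y 6) := by
    rw [hxe, hye]; simp [mul_def, mulFun, map_ofNat]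
  have P3 : (x * y) 3 = 4⁻¹ * (x 6 * y 9 - x 9 * y 6) := by
    rw [hxe, hye]; simp [mul_def, mulFun, map_ofNat]
  have P4 : (x * y) 4 = 4⁻¹ * (x 7 * y 8 - x 8 * y 7) := by
    rw [hxe, hye]; simp [mul_def, mulFun, map_ofNat]
  -- The functions `id` and `σ` are linearly independent over `K`.
  have hsep (α β : K) (h' : ∀ c : K, α * c + β * σ c = 0) : α = 0 ∧ β = 0 := by
    have h1 := h' 1
    rw [map_one] at h1
    have hβ : β * (σ κ - κ) = 0 := by linear_combination h' κ - κ * h1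
    have hβ0 := (mul_eq_zero.1 hβ).resolve_right (sub_ne_zero.2 hκ)
    exact ⟨by simpa [hβ0] using h1, hβ0⟩
  generalize x * y = P at h P0 P1 P2 P3 P4
  have hz (c d : K) : P * oddE c d (σ c) (σ d) =
      (8⁻¹ : F) • oddE c d (σ c) (σ d) := by
    apply h
    · rw [mem_fixedK10]
      funext i; fin_cases i <;> simp [tauSigmaFun, hσ2]
    · exact oddE_mem_odd _ _ _ _ _
  obtain ⟨hα, h3⟩ := hsep (P 0 + 2⁻¹ * P 1 - 8⁻¹) (-(2⁻¹ * P 3)) fun c => by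
    have := congrFun (hz c 0) 6
    simp [mul_def, mulFun, Algebra.smul_def, map_ofNat] at this
    linear_combination this
  obtain ⟨-, h2w⟩ := hsep 0 (2⁻¹ * P 2) fun c => by
    have := congrFun (hz 0 c) 6
    simp [mul_def, mulFun, Algebra.smul_def, map_ofNat] at this
    simpa [h2] using this
  obtain ⟨-, h4w⟩ := hsep (P 0 + 2⁻¹ * P 1 - 8⁻¹) (2⁻¹ * P 4) fun c => by
    have := congrFun (hz 0 c) 7
    simp [mul_def, mulFun, Algebra.smul_def, map_ofNat] at this
    linear_combination this
  simp only [neg_eq_zero, mul_eq_zero, inv_eq_zero, h2, false_or] at h3 h2w h4w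
  rw [h2w, eq_comm, mul_eq_zero, inv_eq_zero, or_iff_right h4] at P2
  rw [h3, eq_comm, mul_eq_zero, inv_eq_zero, or_iff_right h4] at P3
  rw [h4w, eq_comm, mul_eq_zero, inv_eq_zero, or_iff_right h4] at P4
  have hω : x 6 * y 7 - x 7 * y 6 + x 8 * y 9 - x 9 * y 8 = 0 := by
    by_cases h6 : x 6 = 0
    · have h8' : x 8 = 0 := by rw [← hx8, h6, map_zero]
      by_cases h7 : x 7 = 0
      · have h9 : x 9 = 0 := by rw [← hx9, h7, map_zero]
        simp [h6, h7, h8', h9]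
      · have h9 : x 9 ≠ 0 := fun h9 => h7 (by rw [← hx7, h9, map_zero])
        simp only [h6, h8', zero_mul, zero_sub, sub_zero, neg_eq_zero, mul_eq_zero, h7, h9,
          false_or] at P3 P4
        simp [h6, h8', P3, P4]
    · have h8' : x 8 ≠ 0 := fun h8' => h6 (by rw [← hx6, h8', map_zero])
      apply mul_left_cancel₀ (mul_ne_zero h6 h8')
      linear_combination x 6 * (x 7 * P2 - x 6 * P4) + x 8 * (x 8 * P3 - x 9 * P2)
  rw [P0, P1, hω] at hα
  simp [h8] at hα

end Descent

/-- In the split form `(u ⊗ a)(v ⊗ a)` acts on the odd part as `1/8`. -/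
lemma exists_odd_mul_odd_acts_as_scalar {F : Type} [Field F] (hchar : (2 : F) ≠ 0) :
    ∃ x ∈ odd F F F, ∃ y ∈ odd F F F, ∀ z ∈ odd F F F, (x * y) * z = (8⁻¹ : F) • z := by
  have h8 : (8 : F) ≠ 0 := by
    have : (8 : F) = 2 ^ 3 := by norm_num
    rw [this]; exact pow_ne_zero _ hchar
  refine ⟨oddE 1 0 0 0, oddE_mem_odd _ _ _ _ _, oddE 0 1 0 0, oddE_mem_odd _ _ _ _ _,
    fun z hz => ?_⟩
  rw [eq_oddE_of_mem_odd hz]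
  funext i
  fin_cases i <;> simp [mul_def, mulFun]
  all_goals (field_simp; ring)

end K10A
end Kac

/-! ### STATEMENT 8 -/

set_option synthInstance.maxHeartbeats 1000000 in
set_option maxHeartbeats 1000000 in
open Kac K10A in
/-- Let `K/F` be a quadratic separable field extension with Galois group
`{id, σ}`.  The set `K₁₀,K = {X ∈ K₁₀ ⊗_F K : (τ⊗σ)(X) = X}` is an
`F`-subspace (realized as the submodule `fixedK10 σ` of `K10A F K`,
the realization of `K₁₀ ⊗_F K`), closed under multiplication, compatible with
the `ℤ/2`-grading, of dimension `10` over `F`; moreover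
`K₁₀,K ⊗_F K ≅ K₁₀ ⊗_F K` as `K`-superalgebras, while `K₁₀,K` is not
isomorphic to `K₁₀` as an `F`-superalgebra. -/
theorem fixed_points_of_tau_sigma_form (F : Type) [Field F] (hchar : (2 : F) ≠ 0)
    (K : Type) [Field K] [Algebra F K] (hquad : Module.finrank F K = 2)
    [Algebra.IsSeparable F K] (σ : K ≃ₐ[F] K) (hσ : σ ≠ (AlgEquiv.refl : K ≃ₐ[F] K))
    (hGal : ∀ τ : K ≃ₐ[F] K, τ = (AlgEquiv.refl : K ≃ₐ[F] K) ∨ τ = σ) :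
    ((fixedK10 σ : Submodule F (K10A F K)) : Set (K10A F K)) =
        {X : K10A F K | tauSigmaFun σ X = X} ∧
    (∀ x y : K10A F K, x ∈ fixedK10 σ → y ∈ fixedK10 σ → x * y ∈ fixedK10 σ) ∧
    (fixedK10 σ = (fixedK10 σ ⊓ even F K F) ⊔ (fixedK10 σ ⊓ odd F K F)) ∧
    Module.finrank F ↥(fixedK10 σ) = 10 ∧
    Nonempty (SuperIso K (K ⊗[F] ↥(fixedK10 σ)) (K10A F K)
      ((fixedEven σ).baseChange K) ((fixedOdd σ).baseChange K)
      (even F K K) (odd F K K)) ∧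
    ¬ Nonempty (SuperIso F (↥(fixedK10 σ)) (K10A F F)
      (fixedEven σ) (fixedOdd σ) (even F F F) (odd F F F)) := by
  have hσ2 (k : K) : σ (σ k) = k := by
    rcases hGal (σ.trans σ) with h | h
    · exact DFunLike.congr_fun h k
    · exact absurd (AlgEquiv.ext fun k => σ.injective (DFunLike.congr_fun h k)) hσ
  obtain ⟨κ, hκ⟩ : ∃ κ, σ κ ≠ κ := by
    by_contra! h
    exact hσ (AlgEquiv.ext h)
  let e : K ⊗[F] ↥(fixedK10 σ) ≃ₗ[K] K10A F K := LinearEquiv.ofBijective (descentMap σ)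
    ⟨descentMap_injective hquad hκ, descentMap_surjective hσ2 hκ⟩
  refine ⟨rfl, fun x y hx hy => ((⟨x, hx⟩ : ↥(fixedK10 σ)) * ⟨y, hy⟩).2, ?_, ?_, ⟨⟨e,
    descentMap_mul σ,
    map_descentMap_baseChange hσ2 hκ _ (fun _ => tauSigmaFun_mem_even) _ (fun _ => Iff.rfl),
    map_descentMap_baseChange hσ2 hκ _ (fun _ => tauSigmaFun_mem_odd) _ (fun _ => Iff.rfl)⟩⟩, ?_⟩
  · exact fixedK10_eq_even_sup_odd σ
  · rw [← Module.finrank_baseChange (R := K), e.finrank_eq]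
    exact Module.finrank_fin_fun K
  · rintro ⟨f⟩
    obtain ⟨x, hx, y, hy, h⟩ := exists_odd_mul_odd_acts_as_scalar hchar
    rw [← f.map_odd] at hx hy
    obtain ⟨x, hx, rfl⟩ := hx
    obtain ⟨y, hy, rfl⟩ := hy
    refine not_odd_mul_odd_acts_as_scalar hchar hσ2 hκ x.2 hx hy fun z hz hzo => ?_
    have hfz : f.e ⟨z, hz⟩ ∈ odd F F F :=
      f.map_odd.le (Submodule.mem_map_of_mem (f := f.e.toLinearMap) hzo)
    have key : x * y * ⟨z, hz⟩ = (8⁻¹ : F) • (⟨z, hz⟩ : ↥(fixedK10 σ)) := by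
      apply f.e.injective
      rw [f.map_mul', f.map_mul', map_smul]
      exact h _ hfz
    exact congrArg Subtype.val key
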